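/- arXiv:1910.13233 — 4 statements merged into one kernel-verified Lean document; each statement's English description precedes it below -/
import Mathlib

section
/- Let D and M be positive integers, let Q be a real D×M matrix with orthonormal columns (QᵀQ = I_M), let R and R̃ be upper-triangular M×M real matrices, and let A be a diagonal M×M real matrix. Then det(I_D + Q R A R̃ Qᵀ) = ∏_{m=1}^{M} (1 + A_{mm} R̃_{mm} R_{mm}). -/
open Matrix

/-- Determinant identity for the Sylvester flow Jacobian: for a D×M matrix `Q` with
orthonormal columns, upper-triangular `R`, `Rt` and diagonal `A`,
`det(I_D + Q R A Rt Qᵀ) = ∏ m, (1 + A m m * Rt m m * R m m)`. -/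
theorem sylvester_det (D M : ℕ) (hD : 0 < D) (hM : 0 < M)
    (Q : Matrix (Fin D) (Fin M) ℝ) (hQ : Qᵀ * Q = 1)
    (R Rt A : Matrix (Fin M) (Fin M) ℝ)
    (hR : ∀ i j, j < i → R i j = 0) (hRt : ∀ i j, j < i → Rt i j = 0)
    (hA : ∀ i j, i ≠ j → A i j = 0) :
    (1 + Q * R * A * Rt * Qᵀ).det = ∏ m, (1 + A m m * Rt m m * R m m) := by
  have diag_mul : ∀ X Y : Matrix (Fin M) (Fin M) ℝ, (∀ i j, j < i → X i j = 0) →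
      (∀ i j, j < i → Y i j = 0) → ∀ m, (X * Y) m m = X m m * Y m m := by
    intro X Y hX hY m
    rw [Matrix.mul_apply]
    apply Finset.sum_eq_single m
    · intro k _ hk
      rcases lt_or_gt_of_ne hk with h | h
      · rw [hX m k h, zero_mul]
      · rw [hY k m h, mul_zero]
    · intro h
      exact absurd (Finset.mem_univ m) h
  have tR : BlockTriangular R id := fun i j h => hR i j h
  have tRt : BlockTriangular Rt id := fun i j h => hRt i j h
  have tA : BlockTriangular A id := fun i j h => hA i j (ne_of_gt h)
  have tRA : BlockTriangular (R * A) id := tR.mul tA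
  have tT : BlockTriangular (R * A * Rt) id := tRA.mul tRt
  have key : (1 + Q * R * A * Rt * Qᵀ).det = (1 + R * A * Rt).det := by
    have e : Q * R * A * Rt * Qᵀ = Q * (R * A * Rt * Qᵀ) := by
      simp only [Matrix.mul_assoc]
    rw [e, Matrix.det_one_add_mul_comm, Matrix.mul_assoc (R * A * Rt), hQ, Matrix.mul_one]
  rw [key, Matrix.det_of_isUpperTriangular (blockTriangular_one.add tT)]
  refine Finset.prod_congr rfl fun m _ => ?_
  rw [Matrix.add_apply, Matrix.one_apply_eq,
    diag_mul (R * A) Rt (fun i j h => tRA h) hRt m,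
    diag_mul R A hR (fun i j h => tA h) m]
  ring
end

section
/- Let h : ℝ → ℝ be differentiable and monotonically increasing with 0 ≤ h'(z) ≤ s for all z, where s > 0. Let Q be a real D×M matrix with orthonormal columns (QᵀQ = I_M), let R and R̃ be upper-triangular M×M real matrices, and let b ∈ ℝ^M. If R̃_{mm} R_{mm} > −1/s for all m = 1,…,M, then the Sylvester flow f : ℝ^D → ℝ^D defined by f(u) = u + Q R h(R̃ Qᵀ u + b), with h applied elementwise, is a bijection of ℝ^D. -/
open Matrix

lemma scalar_bij (s : ℝ) (hs : 0 < s) (h : ℝ → ℝ) (hdiff : Differentiable ℝ h)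
    (hderiv : ∀ z, 0 ≤ deriv h z ∧ deriv h z ≤ s) (r t c d : ℝ) (hc : t * r > -(1 / s)) :
    Function.Bijective (fun x : ℝ => x + r * h (t * x + c) + d) := by
  obtain ⟨e, he, hle⟩ : ∃ e : ℝ, 0 < e ∧ ∀ z, e ≤ 1 + r * (deriv h z * t) := by
    have h1 : 0 < 1 + t * r * s := by
      have : -(1 / s) * s < t * r * s := mul_lt_mul_of_pos_right hc hs
      have h2 : -(1 / s) * s = -1 := by field_simp
      linarith
    refine ⟨min 1 (1 + t * r * s), lt_min one_pos h1, fun z => ?_⟩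
    obtain ⟨h0, h2⟩ := hderiv z
    rcases le_total 0 (t * r) with h3 | h3
    · refine (min_le_left _ _).trans ?_
      nlinarith [mul_nonneg h3 h0]
    · refine (min_le_right _ _).trans ?_
      nlinarith [mul_le_mul_of_nonpos_left h2 h3]
  have hd : ∀ x, HasDerivAt (fun x : ℝ => x + r * h (t * x + c) + d - e * x)
      (1 + r * (deriv h (t * x + c) * t) - e) x := by
    intro x
    have hin : HasDerivAt (fun x : ℝ => t * x + c) t x := by
      simpa using ((hasDerivAt_id x).const_mul t).add_const c
    have hh := (hdiff (t * x + c)).hasDerivAt.comp x hin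
    have := (((hasDerivAt_id x).add (hh.const_mul r)).add_const d).sub
      ((hasDerivAt_id x).const_mul e)
    refine (this.congr_deriv (by simp)).congr_of_eventuallyEq (Filter.Eventually.of_forall fun y => ?_)
    simp
  have hm : Monotone (fun x : ℝ => x + r * h (t * x + c) + d - e * x) := by
    apply monotone_of_deriv_nonneg (fun x => (hd x).differentiableAt)
    intro x
    rw [(hd x).deriv]
    linarith [hle (t * x + c)]
  constructor
  · have : StrictMono (fun x : ℝ => x + r * h (t * x + c) + d) := by
      intro x y hxy
      have := hm hxy.le
      have h2 := mul_lt_mul_of_pos_left hxy he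
      simp only at this ⊢
      linarith
    exact this.injective
  · have hcont : Continuous (fun x : ℝ => x + r * h (t * x + c) + d) := by
      have := hdiff.continuous
      fun_prop
    apply hcont.surjective
    · apply Filter.tendsto_atTop_mono' _ _
        (Filter.tendsto_atTop_add_const_right _ (0 + r * h (t * 0 + c) + d - e * 0)
          (Filter.tendsto_id.const_mul_atTop he))
      filter_upwards [Filter.eventually_ge_atTop 0] with x hx
      have := hm hx
      simp only [id] at this ⊢
      linarith
    · apply Filter.tendsto_atBot_mono' _ _
        (Filter.tendsto_atBot_add_const_right _ (0 + r * h (t * 0 + c) + d - e * 0)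
          (Filter.tendsto_id.const_mul_atBot he))
      filter_upwards [Filter.eventually_le_atBot 0] with x hx
      have := hm hx
      simp only [id] at this ⊢
      linarith

lemma tri_bij (M : ℕ) (G : (Fin M → ℝ) → (Fin M → ℝ))
    (hdep : ∀ i v w, (∀ j, i ≤ j → v j = w j) → G v i = G w i)
    (hb : ∀ i v, Function.Bijective (fun x : ℝ => G (Function.update v i x) i)) :
    Function.Bijective G := by
  constructor
  · intro v w hvw
    have key : ∀ k : ℕ, ∀ i : Fin M, M - k ≤ i → v i = w i := by
      intro k
      induction k with
      | zero => intro i hi; omega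
      | succ k ih =>
        intro i hi
        by_cases hik : M - k ≤ i
        · exact ih i hik
        apply (hb i v).1
        have h1 : G (Function.update v i (w i)) i = G w i := by
          apply hdep
          intro j hj
          by_cases hji : j = i
          · subst hji; simp
          · rw [Function.update_of_ne hji]
            apply ih
            have : i < j := lt_of_le_of_ne hj (Ne.symm hji)
            have : (i : ℕ) < j := this
            omega
        simp only [Function.update_eq_self]
        rw [h1, hvw]
    funext i
    exact key M i (by omega)
  · intro y
    have key : ∀ k : ℕ, ∃ v, ∀ i : Fin M, M - k ≤ i → G v i = y i := by
      intro k
      induction k with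
      | zero => exact ⟨0, fun i hi => by omega⟩
      | succ k ih =>
        obtain ⟨v, hv⟩ := ih
        by_cases hk : M ≤ k
        · exact ⟨v, fun i hi => hv i (by omega)⟩
        let i0 : Fin M := ⟨M - (k + 1), by omega⟩
        obtain ⟨x, hx⟩ := (hb i0 v).2 (y i0)
        refine ⟨Function.update v i0 x, fun i hi => ?_⟩
        by_cases hii : i = i0
        · rw [hii]; exact hx
        have hne : (i : ℕ) ≠ M - (k + 1) := fun hh => hii (Fin.ext hh)
        rw [← hv i (by omega)]
        apply hdep
        intro j hj
        have hj' : (i : ℕ) ≤ j := hj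
        apply Function.update_of_ne
        intro hh
        have : (j : ℕ) = M - (k + 1) := by rw [hh]
        omega
    obtain ⟨v, hv⟩ := key M
    exact ⟨v, funext fun i => hv i (by omega)⟩

/-- Invertibility of the Sylvester flow `f(u) = u + Q R h(Rt Qᵀ u + b)`. -/
theorem sylvester_flow_bijective (D M : ℕ) (s : ℝ) (hs : 0 < s)
    (h : ℝ → ℝ) (hdiff : Differentiable ℝ h) (hmono : Monotone h)
    (hderiv : ∀ z, 0 ≤ deriv h z ∧ deriv h z ≤ s)
    (Q : Matrix (Fin D) (Fin M) ℝ) (hQ : Qᵀ * Q = 1)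
    (R Rt : Matrix (Fin M) (Fin M) ℝ)
    (hR : ∀ i j, j < i → R i j = 0) (hRt : ∀ i j, j < i → Rt i j = 0)
    (b : Fin M → ℝ)
    (hcond : ∀ m, Rt m m * R m m > -(1 / s)) :
    Function.Bijective (fun u : Fin D → ℝ =>
      u + Q.mulVec (R.mulVec (fun m => h (Rt.mulVec (Qᵀ.mulVec u) m + b m)))) := by
  have hG : Function.Bijective (fun v : Fin M → ℝ =>
      v + R.mulVec (fun m => h (Rt.mulVec v m + b m))) := by
    apply tri_bij
    · intro i v w hvw
      simp only [Pi.add_apply, hvw i le_rfl, Matrix.mulVec, dotProduct]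
      congr 1
      refine Finset.sum_congr rfl fun j _ => ?_
      rcases lt_or_ge j i with hj | hj
      · simp [hR i j hj]
      congr 3
      refine Finset.sum_congr rfl fun k _ => ?_
      rcases lt_or_ge k j with hk | hk
      · simp [hRt j k hk]
      rw [hvw k (hj.trans hk)]
    · intro i v
      have hu : ∀ x j, Rt.mulVec (Function.update v i x) j
          = Rt j i * x + Rt.mulVec (Function.update v i 0) j := by
        intro x j
        have : Function.update v i x = Pi.single i x + Function.update v i 0 := by
          funext k
          by_cases hk : k = i
          · subst hk; simp
          · simp [hk]
        rw [this, Matrix.mulVec_add]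
        simp [Matrix.mulVec_single, mul_comm]
      convert scalar_bij s hs h hdiff hderiv (R i i) (Rt i i)
        (Rt.mulVec (Function.update v i 0) i + b i)
        (∑ j ∈ Finset.univ.erase i, R i j * h (Rt.mulVec (Function.update v i 0) j + b j))
        (hcond i) using 2 with x
      simp only [Pi.add_apply, Function.update_self]
      rw [Matrix.mulVec, dotProduct, ← Finset.add_sum_erase _ _ (Finset.mem_univ i), hu x i,
        add_assoc, add_assoc]
      congr 2
      refine Finset.sum_congr rfl fun j hj => ?_
      have hne := Finset.ne_of_mem_erase hj
      rcases lt_or_gt_of_ne hne with hj | hj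
      · simp [hR i j hj]
      · rw [hu x j, hRt j i hj]; simp
  have hQQ : ∀ w : Fin M → ℝ, Qᵀ.mulVec (Q.mulVec w) = w := by
    intro w; rw [Matrix.mulVec_mulVec, hQ, Matrix.one_mulVec]
  constructor
  · intro u u' huu
    have h1 := congrArg (fun z => Qᵀ.mulVec z) huu
    simp only [Matrix.mulVec_add, hQQ] at h1
    have h2 : Qᵀ.mulVec u = Qᵀ.mulVec u' := hG.1 h1
    simp only [h2] at huu
    exact add_right_cancel huu
  · intro y
    obtain ⟨v, hv⟩ := hG.2 (Qᵀ.mulVec y)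
    refine ⟨y - Q.mulVec (R.mulVec (fun m => h (Rt.mulVec v m + b m))), ?_⟩
    have h3 : Qᵀ.mulVec (y - Q.mulVec (R.mulVec (fun m => h (Rt.mulVec v m + b m)))) = v := by
      rw [Matrix.mulVec_sub, hQQ, ← hv]
      simp
    simp only [h3]
    simp
end

section
/- Let α, β, γ, δ, ε ∈ ℝ with δ > 0 and α > (9/(8√3)) |γ| δ. Then the non-linear squared flow g : ℝ → ℝ defined by g(u) = α u + β + γ/(1 + (δu + ε)²) is strictly increasing and is a bijection from ℝ to ℝ. -/
lemma nsf_key (x : ℝ) : |2 * x| ≤ 9 / (8 * Real.sqrt 3) * (1 + x ^ 2) ^ 2 := by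
  have hs : 0 < Real.sqrt 3 := by positivity
  have h3 : Real.sqrt 3 ^ 2 = 3 := Real.sq_sqrt (by norm_num)
  have hx : x ^ 2 = |x| ^ 2 := (sq_abs x).symm
  rw [abs_mul, abs_two, hx, div_mul_eq_mul_div, le_div_iff₀ (by positivity)]
  have ht : 0 ≤ |x| := abs_nonneg x
  generalize |x| = t at *
  generalize Real.sqrt 3 = s at *
  have h : 0 ≤ (s * t - 1) ^ 2 * ((s * t) ^ 2 + 2 * (s * t) + 9) := by positivity
  have e : (s * t - 1) ^ 2 * ((s * t) ^ 2 + 2 * (s * t) + 9)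
      = 9 * (1 + t ^ 2) ^ 2 - 2 * t * (8 * s) := by
    have : (s * t) ^ 2 = 3 * t ^ 2 := by rw [mul_pow, h3]
    linear_combination ((s * t) ^ 2 + 3 * t ^ 2 + 6) * this
  linarith

/-- Invertibility of the non-linear squared flow
`g(u) = α u + β + γ / (1 + (δ u + ε)²)` under the constraints `δ > 0` and
`α > (9/(8√3)) |γ| δ`: it is strictly increasing and a bijection of `ℝ`. -/
theorem nonlinear_squared_flow_bijective (α β γ δ ε : ℝ) (hδ : 0 < δ)
    (hα : 9 / (8 * Real.sqrt 3) * |γ| * δ < α) :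
    StrictMono (fun u : ℝ => α * u + β + γ / (1 + (δ * u + ε) ^ 2)) ∧
    Function.Bijective (fun u : ℝ => α * u + β + γ / (1 + (δ * u + ε) ^ 2)) := by
  have hα0 : 0 < α := lt_of_le_of_lt (by positivity) hα
  have hpos : ∀ u : ℝ, 0 < 1 + (δ * u + ε) ^ 2 := fun u => by positivity
  have hd : ∀ u : ℝ, HasDerivAt (fun u : ℝ => α * u + β + γ / (1 + (δ * u + ε) ^ 2))
      (α - γ * δ * (2 * (δ * u + ε)) / (1 + (δ * u + ε) ^ 2) ^ 2) u := by
    intro u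
    have h1 : HasDerivAt (fun u : ℝ => δ * u + ε) (δ * 1) u :=
      ((hasDerivAt_id' u).const_mul δ).add_const ε
    have h2 := (h1.fun_pow 2).const_add 1
    have h3 := (((hasDerivAt_id' u).const_mul α).add_const β).fun_add
      ((hasDerivAt_const u γ).fun_div h2 (hpos u).ne')
    refine h3.congr_deriv ?_
    push_cast
    ring
  have hmono : StrictMono (fun u : ℝ => α * u + β + γ / (1 + (δ * u + ε) ^ 2)) := by
    apply strictMono_of_deriv_pos
    intro u
    rw [(hd u).deriv, sub_pos]
    refine lt_of_le_of_lt ?_ hα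
    rw [div_le_iff₀ (by have := hpos u; positivity)]
    have hk := nsf_key (δ * u + ε)
    calc γ * δ * (2 * (δ * u + ε)) ≤ |γ * δ * (2 * (δ * u + ε))| := le_abs_self _
      _ = |γ| * δ * |2 * (δ * u + ε)| := by rw [abs_mul, abs_mul γ, abs_of_pos hδ]
      _ ≤ |γ| * δ * (9 / (8 * Real.sqrt 3) * (1 + (δ * u + ε) ^ 2) ^ 2) := by gcongr
      _ = _ := by ring
  have hb : ∀ u : ℝ, |γ / (1 + (δ * u + ε) ^ 2)| ≤ |γ| := by
    intro u
    rw [abs_div, abs_of_pos (hpos u)]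
    exact div_le_self (abs_nonneg _) (by nlinarith [sq_nonneg (δ * u + ε)])
  have hc : Continuous (fun u : ℝ => α * u + β + γ / (1 + (δ * u + ε) ^ 2)) :=
    continuous_iff_continuousAt.2 fun u => (hd u).continuousAt
  refine ⟨hmono, hmono.injective, hc.surjective ?_ ?_⟩
  · refine Filter.tendsto_atTop_mono (f := fun u => α * u + (β - |γ|)) ?_
      (Filter.tendsto_atTop_add_const_right _ _ (Filter.tendsto_id.const_mul_atTop hα0))
    intro u
    have := (abs_le.1 (hb u)).1
    linarith
  · refine Filter.tendsto_atBot_mono (f := fun u => α * u + (β + |γ|)) ?_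
      (Filter.tendsto_atBot_add_const_right _ _ (Filter.tendsto_id.const_mul_atBot hα0))
    intro u
    have := (abs_le.1 (hb u)).2
    linarith
end

section
/- Let f : ℝ^D → ℝ be a bounded probability density that is continuous at a point x ∈ ℝ^D, let k₁ : ℝ^D → ℝ be a bounded, compactly supported probability density, and define k_ε(u) = ε^{−D} k₁(u/ε). For each N let X₁,…,X_N be i.i.d. with density f, let ε_N > 0, and set q_N(x) = (1/N) Σ_{n=1}^N k_{ε_N}(x − X_n). If ε_N → 0 and N ε_N^{2D} → ∞ as N → ∞, then q_N(x) → f(x) in probability. -/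
open MeasureTheory Filter

lemma kde_avg_bound {E : Type*} [MeasurableSpace E] (μ : Measure E) [IsProbabilityMeasure μ]
    (g : E → ℝ) (hg : Measurable g) (B : ℝ) (h0 : ∀ y, 0 ≤ g y) (hB : ∀ y, g y ≤ B)
    (N : ℕ) (hN : 0 < N) (c : ℝ) (hc : 0 < c) :
    (Measure.pi fun _ : Fin N => μ)
      {X : Fin N → E | c ≤ |(1 / N : ℝ) * ∑ n, g (X n) - ∫ y, g y ∂μ|}
      ≤ ENNReal.ofReal (B ^ 2 / (N * c ^ 2)) := by
  have hmem : MemLp g 2 μ :=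
    memLp_of_bounded (a := 0) (b := B) (ae_of_all _ fun y => ⟨h0 y, hB y⟩)
      hg.aestronglyMeasurable 2
  have hev : ∀ i : Fin N, MeasurePreserving (Function.eval i)
      (Measure.pi fun _ : Fin N => μ) μ := fun i =>
    measurePreserving_eval (fun _ : Fin N => μ) i
  have hmemi : ∀ i : Fin N, MemLp (fun X : Fin N → E => g (X i)) 2
      (Measure.pi fun _ : Fin N => μ) := fun i => hmem.comp_measurePreserving (hev i)
  have hmemS : MemLp (fun X : Fin N → E => (1 / N : ℝ) * ∑ n, g (X n)) 2
      (Measure.pi fun _ : Fin N => μ) :=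
    (memLp_finsetSum Finset.univ fun i _ => hmemi i).const_mul _
  have hNr : (0 : ℝ) < N := by exact_mod_cast hN
  have hmean : ∫ X, (1 / N : ℝ) * ∑ n, g (X n) ∂(Measure.pi fun _ : Fin N => μ)
      = ∫ y, g y ∂μ := by
    rw [integral_const_mul, integral_finsetSum _ fun i _ => (hmemi i).integrable (by norm_num)]
    have : ∀ i : Fin N, ∫ X, g (X i) ∂(Measure.pi fun _ : Fin N => μ) = ∫ y, g y ∂μ := by
      intro i
      exact integral_comp_eval (μ := fun _ : Fin N => μ) (i := i) hg.aestronglyMeasurable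
    simp only [this]
    simp
    field_simp
  have hvar : ProbabilityTheory.variance (fun X : Fin N → E => (1 / N : ℝ) * ∑ n, g (X n))
      (Measure.pi fun _ : Fin N => μ) ≤ B ^ 2 / N := by
    rw [ProbabilityTheory.variance_const_mul]
    have h1 := ProbabilityTheory.variance_sum_pi (ι := Fin N) (μ := fun _ => μ)
      (X := fun _ => g) (fun _ => hmem)
    have h2 : (∑ i : Fin N, fun ω : Fin N → E => g (ω i)) = fun X => ∑ n, g (X n) := by
      ext; simp
    rw [h2] at h1
    rw [h1]
    have h3 : ProbabilityTheory.variance g μ ≤ ((B - 0) / 2) ^ 2 :=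
      ProbabilityTheory.variance_le_sq_of_bounded (ae_of_all _ fun y => ⟨h0 y, hB y⟩)
        hg.aemeasurable
    have h4 : ProbabilityTheory.variance g μ ≤ B ^ 2 := by nlinarith [sq_nonneg B]
    simp only [Finset.sum_const, Finset.card_univ, Fintype.card_fin, nsmul_eq_mul]
    calc (1 / N : ℝ) ^ 2 * (N * ProbabilityTheory.variance g μ)
        = ProbabilityTheory.variance g μ / N := by field_simp
      _ ≤ B ^ 2 / N := by gcongr
  have key := ProbabilityTheory.meas_ge_le_variance_div_sq hmemS hc
  rw [hmean] at key
  refine key.trans (ENNReal.ofReal_le_ofReal ?_)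
  rw [← div_div]
  gcongr

lemma kde_mean (D : ℕ) (f : (Fin D → ℝ) → ℝ) (hf_meas : Measurable f)
    (hf_nonneg : ∀ y, 0 ≤ f y) (x : Fin D → ℝ) (k₁ : (Fin D → ℝ) → ℝ) (e : ℝ) (he : 0 < e) :
    ∫ y, (e ^ D)⁻¹ * k₁ (e⁻¹ • (x - y))
      ∂(volume.withDensity fun y => ENNReal.ofReal (f y))
      = ∫ u, k₁ u * f (x - e • u) := by
  rw [integral_withDensity_eq_integral_toReal_smul (by fun_prop) (by simp)]
  rw [← integral_sub_left_eq_self _ volume x]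
  have h := Measure.integral_comp_inv_smul (volume : Measure (Fin D → ℝ))
    (fun u => k₁ u * f (x - e • u)) e
  simp only [smul_inv_smul₀ he.ne', Module.finrank_fin_fun, abs_of_pos (pow_pos he D),
    smul_eq_mul] at h
  have h2 : ∫ u, k₁ u * f (x - e • u) = (e ^ D)⁻¹ * ∫ z, k₁ (e⁻¹ • z) * f (x - z) := by
    rw [h, inv_mul_cancel_left₀ (pow_pos he D).ne']
  rw [h2, ← integral_const_mul]
  congr 1
  ext z
  simp only [sub_sub_cancel, smul_eq_mul, ENNReal.toReal_ofReal (hf_nonneg _)]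
  ring

/-- Consistency of the kernel density estimator: if the true density `f` is bounded and
continuous at `x`, the kernel `k₁` is a bounded compactly supported density, the
bandwidths satisfy `ε_N → 0` and `N ε_N^{2D} → ∞`, then `q_N(x) → f(x)` in probability. -/
theorem kde_consistent (D : ℕ) (f : (Fin D → ℝ) → ℝ) (hf_meas : Measurable f)
    (hf_nonneg : ∀ y, 0 ≤ f y) (Cf : ℝ) (hf_bdd : ∀ y, f y ≤ Cf) (hf_int : ∫ y, f y = 1)
    (x : Fin D → ℝ) (hf_cont : ContinuousAt f x)
    (k₁ : (Fin D → ℝ) → ℝ) (hk_meas : Measurable k₁) (hk_nonneg : ∀ u, 0 ≤ k₁ u)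
    (Ck : ℝ) (hk_bdd : ∀ u, k₁ u ≤ Ck) (hk_supp : HasCompactSupport k₁)
    (hk_int : ∫ u, k₁ u = 1)
    (ε : ℕ → ℝ) (hε_pos : ∀ N, 0 < ε N) (hε0 : Tendsto ε atTop (nhds 0))
    (hNε : Tendsto (fun N : ℕ => (N : ℝ) * ε N ^ (2 * D)) atTop atTop) :
    ∀ t : ℝ, 0 < t → Tendsto
      (fun N : ℕ =>
        (Measure.pi fun _ : Fin N => volume.withDensity fun y => ENNReal.ofReal (f y))
          {X : Fin N → (Fin D → ℝ) |
            t < |(1 / N : ℝ) * ∑ n, (ε N ^ D)⁻¹ * k₁ ((ε N)⁻¹ • (x - X n)) - f x|})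
      atTop (nhds 0) := by
  intro t ht
  have hfi : Integrable f := by
    by_contra h
    rw [integral_undef h] at hf_int
    exact zero_ne_one hf_int
  have hki : Integrable k₁ := by
    by_contra h
    rw [integral_undef h] at hk_int
    exact zero_ne_one hk_int
  have hprob : IsProbabilityMeasure
      ((volume : Measure (Fin D → ℝ)).withDensity fun y => ENNReal.ofReal (f y)) := by
    constructor
    rw [withDensity_apply _ MeasurableSet.univ, setLIntegral_univ,
      ← ofReal_integral_eq_lintegral_ofReal hfi (ae_of_all _ hf_nonneg), hf_int]
    simp
  -- the bias vanishes
  have hmean : Tendsto (fun N => ∫ u, k₁ u * f (x - ε N • u)) atTop (nhds (f x)) := by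
    have h1 : f x = ∫ u, k₁ u * f x := by rw [integral_mul_const, hk_int, one_mul]
    rw [h1]
    refine tendsto_integral_of_dominated_convergence (fun u => k₁ u * Cf) ?_
      (hki.mul_const _) ?_ ?_
    · intro N
      exact Measurable.aestronglyMeasurable (by fun_prop)
    · intro N
      refine ae_of_all _ fun u => ?_
      rw [Real.norm_of_nonneg (mul_nonneg (hk_nonneg _) (hf_nonneg _))]
      exact mul_le_mul_of_nonneg_left (hf_bdd _) (hk_nonneg _)
    · refine ae_of_all _ fun u => ?_
      refine Tendsto.const_mul _ (hf_cont.tendsto.comp ?_)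
      have := (hε0.smul_const u).const_sub x
      simpa using this
  have hbias : ∀ᶠ N in atTop, |(∫ u, k₁ u * f (x - ε N • u)) - f x| < t / 2 := by
    have := (Metric.tendsto_nhds.1 hmean) (t / 2) (by positivity)
    simpa [Real.dist_eq] using this
  have hlim : Tendsto (fun N : ℕ => ENNReal.ofReal
      (((ε N ^ D)⁻¹ * Ck) ^ 2 / (N * (t / 2) ^ 2))) atTop (nhds 0) := by
    rw [← ENNReal.ofReal_zero]
    refine ENNReal.tendsto_ofReal ?_
    have h := (tendsto_inv_atTop_zero.comp hNε).const_mul (Ck ^ 2 / (t / 2) ^ 2)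
    rw [mul_zero] at h
    refine h.congr fun N => ?_
    have := hε_pos N
    simp only [Function.comp]
    rw [mul_pow, inv_pow, ← pow_mul, mul_comm D 2, mul_inv]
    simp only [div_eq_mul_inv, mul_inv]
    ring
  refine tendsto_of_tendsto_of_tendsto_of_le_of_le' tendsto_const_nhds hlim
    (Eventually.of_forall fun _ => zero_le) ?_
  filter_upwards [hbias, eventually_gt_atTop 0] with N hb hN
  have hp : 0 < (ε N ^ D)⁻¹ := inv_pos.2 (pow_pos (hε_pos N) D)
  refine le_trans (measure_mono ?_) (kde_avg_bound
    ((volume : Measure (Fin D → ℝ)).withDensity fun y => ENNReal.ofReal (f y))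
    (fun y => (ε N ^ D)⁻¹ * k₁ ((ε N)⁻¹ • (x - y))) (by fun_prop) ((ε N ^ D)⁻¹ * Ck)
    (fun y => mul_nonneg hp.le (hk_nonneg _))
    (fun y => mul_le_mul_of_nonneg_left (hk_bdd _) hp.le) N hN (t / 2) (by positivity))
  intro X hX
  simp only [Set.mem_ofPred_eq] at hX ⊢
  rw [kde_mean D f hf_meas hf_nonneg x k₁ (ε N) (hε_pos N)]
  have := abs_sub_le ((1 / N : ℝ) * ∑ n, (ε N ^ D)⁻¹ * k₁ ((ε N)⁻¹ • (x - X n)))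
    (∫ u, k₁ u * f (x - ε N • u)) (f x)
  linarith
end
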